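/- Let X be a strongly locally finite CAT(0) cube complex and let α: ℝ → X be a bi-infinite combinatorial geodesic; let v^+ and v^- be the simplices of ∂X represented by W(α([0,∞))) and W(α((-∞,0])) respectively. Then v^- and v^+ lie in different connected components of ∂X if and only if α has super-linear divergence, i.e. for all real A, B there exists r ≥ 0 such that every r-avoiding path (with respect to α(0)) joining α(-r) to α(r) has length greater than A r + B. -/

import Mathlib

/-!
Combinatorial model of a CAT(0) cube complex via Sageev duality.

`V` is the set of 0-cubes, `H` the set of hyperplanes, and `side h x : Bool`
records which halfspace of the hyperplane `h` contains the 0-cube `x`.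
The axioms say exactly that `V` is the set of consistent orientations of the
hyperplanes, each differing from a fixed one on finitely many hyperplanes;
this is precisely the combinatorial data of (the 0-skeleton of) a CAT(0) cube
complex, together with its hyperplane structure.
-/
structure CCC where
  V : Type
  H : Type
  side : H → V → Bool
  nonempty_V : Nonempty V
  vertex_ext : ∀ x y : V, (∀ h, side h x = side h y) → x = y
  sep_finite : ∀ x y : V, {h : H | side h x ≠ side h y}.Finite
  halfspace_nonempty : ∀ h b, ∃ x, side h x = b
  hyp_inj : ∀ h h' : H, (∀ x, side h x = side h' x) → h = h'
  hyp_inj' : ∀ h h' : H, (∀ x, side h x = !(side h' x)) → h = h'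
  realize : ∀ (o : H → Bool) (x : V),
    (∀ h h', ∃ y, side h y = o h ∧ side h' y = o h') →
    {h : H | o h ≠ side h x}.Finite →
    ∃ y, ∀ h, side h y = o h

namespace CCC

variable (X : CCC)

/-- The combinatorial (1-skeleton) distance between 0-cubes: the number of
separating hyperplanes. -/
noncomputable def dist (x y : X.V) : ℕ := (X.sep_finite x y).toFinset.card

/-- Two 0-cubes are adjacent (joined by a 1-cube) iff exactly one hyperplane
separates them. -/
def Adj (x y : X.V) : Prop :=
  ∃ h, X.side h x ≠ X.side h y ∧ ∀ h', X.side h' x ≠ X.side h' y → h' = h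

/-- Two hyperplanes cross iff all four quarter-spaces are nonempty. -/
def Crosses (h h' : X.H) : Prop :=
  ∀ b b' : Bool, ∃ x, X.side h x = b ∧ X.side h' x = b'

/-- The hyperplane `h'` lies in the halfspace `b` of the hyperplane `h`. -/
def InHalf (h' h : X.H) (b : Bool) : Prop :=
  h' ≠ h ∧ ∃ c : Bool, ∀ x, X.side h x = !b → X.side h' x = c

/-- `h` separates the hyperplanes `h₁` and `h₂`. -/
def SepH (h h₁ h₂ : X.H) : Prop :=
  ∃ b : Bool, X.InHalf h₁ h b ∧ X.InHalf h₂ h (!b)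

/-- Two distinct hyperplanes contact iff no third hyperplane separates them. -/
def Contact (h h' : X.H) : Prop := h ≠ h' ∧ ¬ ∃ h'', X.SepH h'' h h'

/-- A facing triple: three distinct hyperplanes, each having a halfspace
containing the other two. -/
def FacingTriple (h₁ h₂ h₃ : X.H) : Prop :=
  h₁ ≠ h₂ ∧ h₁ ≠ h₃ ∧ h₂ ≠ h₃ ∧
  ∃ b₁ b₂ b₃ : Bool,
    X.InHalf h₂ h₁ b₁ ∧ X.InHalf h₃ h₁ b₁ ∧
    X.InHalf h₁ h₂ b₂ ∧ X.InHalf h₃ h₂ b₂ ∧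
    X.InHalf h₁ h₃ b₃ ∧ X.InHalf h₂ h₃ b₃

/-- A set of hyperplanes is inseparable if every hyperplane separating two of
its members belongs to it. -/
def Inseparable (U : Set X.H) : Prop :=
  ∀ u ∈ U, ∀ u' ∈ U, ∀ h, X.SepH h u u' → h ∈ U

/-- A set of hyperplanes is unidirectional if each member has a halfspace
containing only finitely many members. -/
def Unidirectional (U : Set X.H) : Prop :=
  ∀ u ∈ U, ∃ b : Bool, {h | h ∈ U ∧ X.InHalf h u b}.Finite

def NoFacingTriple (U : Set X.H) : Prop :=
  ∀ h₁ ∈ U, ∀ h₂ ∈ U, ∀ h₃ ∈ U, ¬ X.FacingTriple h₁ h₂ h₃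

/-- A unidirectional boundary set (UBS). -/
def IsUBS (U : Set X.H) : Prop :=
  U.Infinite ∧ X.Inseparable U ∧ X.Unidirectional U ∧ X.NoFacingTriple U

/-- Almost-equivalence: finite symmetric difference. -/
def AlmostEq (U U' : Set X.H) : Prop := (symmDiff U U').Finite

/-- A minimal UBS. -/
def MinUBS (U : Set X.H) : Prop :=
  X.IsUBS U ∧ ∀ U' ⊆ U, X.IsUBS U' → X.AlmostEq U U'

/-- The simplex (= almost-equivalence class of UBSs) represented by `U` is a
face of the simplex represented by `V`. -/
def FaceOf (U V : Set X.H) : Prop :=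
  ∃ U' V', X.IsUBS U' ∧ X.IsUBS V' ∧ X.AlmostEq U U' ∧ X.AlmostEq V V' ∧ U' ⊆ V'

/-- `U` decomposes, up to almost-equivalence, into `k` pairwise disjoint
minimal UBSs; i.e. the class of `U` is a `(k-1)`-simplex of `∂X`. -/
def HasDim (U : Set X.H) (k : ℕ) : Prop :=
  ∃ 𝒰 : Fin k → Set X.H, (∀ i, X.MinUBS (𝒰 i)) ∧
    (∀ i j, i ≠ j → Disjoint (𝒰 i) (𝒰 j)) ∧ X.AlmostEq U (⋃ i, 𝒰 i)

/-- No infinite family of pairwise-crossing hyperplanes. -/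
def NoInfiniteCrossing : Prop :=
  ∀ S : Set X.H, (∀ h ∈ S, ∀ h' ∈ S, h ≠ h' → X.Crosses h h') → S.Finite

def LocallyFinite : Prop := ∀ x : X.V, {y | X.Adj x y}.Finite

/-- A combinatorial geodesic ray (parameterized by its vertices). -/
def IsGeodesicRay (γ : ℕ → X.V) : Prop :=
  ∀ m n : ℕ, m ≤ n → X.dist (γ m) (γ n) = n - m

/-- A bi-infinite combinatorial geodesic. -/
def IsGeodesicLine (α : ℤ → X.V) : Prop :=
  ∀ m n : ℤ, m ≤ n → (X.dist (α m) (α n) : ℤ) = n - m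

/-- A combinatorial geodesic segment of length `n`. -/
def IsGeodSeg (c : ℕ → X.V) (n : ℕ) : Prop :=
  ∀ i j : ℕ, i ≤ j → j ≤ n → X.dist (c i) (c j) = j - i

/-- The set of hyperplanes crossing (dual to the 1-cubes of) the path `γ`. -/
def WSet (γ : ℕ → X.V) : Set X.H :=
  {h | ∃ n : ℕ, X.side h (γ n) ≠ X.side h (γ (n+1))}

/-- The 0-cubes of the carrier `N(h)` of the hyperplane `h`. -/
def carrier (h : X.H) : Set X.V :=
  {x | ∃ y, X.Adj x y ∧ X.side h x ≠ X.side h y}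

/-- An essential hyperplane: each halfspace contains 0-cubes arbitrarily far
from the carrier. -/
def EssentialHyp (h : X.H) : Prop :=
  ∀ b : Bool, ∀ n : ℕ, ∃ x, X.side h x = b ∧ ∀ y ∈ X.carrier h, n ≤ X.dist x y

/-- Combinatorial convexity of a set of 0-cubes (the 0-skeleton of a convex
subcomplex). -/
def IsConvexSet (S : Set X.V) : Prop :=
  ∀ x ∈ S, ∀ y ∈ S, ∀ z, X.dist x z + X.dist z y = X.dist x y → z ∈ S

/-- `x` and `y` are joined by a combinatorial path avoiding `S`. -/
def ReachAvoid (S : Set X.V) (x y : X.V) : Prop :=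
  ∃ (n : ℕ) (c : ℕ → X.V), c 0 = x ∧ c n = y ∧
    (∀ i < n, X.Adj (c i) (c (i+1))) ∧ ∀ i ≤ n, c i ∉ S

/-- No compact (finite) convex subcomplex disconnects `X`. -/
def CompactlyIndecomposable : Prop :=
  ∀ K : Set X.V, K.Finite → X.IsConvexSet K →
    ∀ x y : X.V, x ∉ K → y ∉ K → X.ReachAvoid K x y

/-- `γ` bounds an eighth-flat: some eighth-flat (the subcomplex of the standard
tiling of `[0,∞)²` below the graph of an unbounded nondecreasing function)
embeds isometrically and cubically in `X` with image containing `γ`. -/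
def BoundsEighthFlat (γ : ℕ → X.V) : Prop :=
  ∃ g : ℕ → ℕ, Monotone g ∧ (∀ N : ℕ, ∃ m, N ≤ g m) ∧
    ∃ e : {p : ℕ × ℕ // p.2 ≤ g p.1} → X.V,
      (∀ p q, X.dist (e p) (e q) = Nat.dist p.1.1 q.1.1 + Nat.dist p.1.2 q.1.2) ∧
      ∀ n : ℕ, ∃ p, e p = γ n

/-- An edge-chain in the contact graph. -/
def CChain (c : ℕ → X.H) (n : ℕ) : Prop := ∀ i < n, X.Contact (c i) (c (i+1))

/-- Distance in the contact graph `C(X)` (`⊤` if there is no path). -/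
noncomputable def cdist (h h' : X.H) : ℕ∞ :=
  sInf {e : ℕ∞ | ∃ (n : ℕ) (c : ℕ → X.H), c 0 = h ∧ c n = h' ∧ X.CChain c n ∧ e = n}

/-- An edge-chain in the crossing graph. -/
def XChain (c : ℕ → X.H) (n : ℕ) : Prop := ∀ i < n, X.Crosses (c i) (c (i+1))

/-- Distance in the crossing graph `Δ(X)`. -/
noncomputable def xdist (h h' : X.H) : ℕ∞ :=
  sInf {e : ℕ∞ | ∃ (n : ℕ) (c : ℕ → X.H), c 0 = h ∧ c n = h' ∧ X.XChain c n ∧ e = n}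

/-- Distance in the full subgraph `Λ(γ)` of the contact graph spanned by the
hyperplanes crossing `γ`. -/
noncomputable def ldist (γ : ℕ → X.V) (h h' : X.H) : ℕ∞ :=
  sInf {e : ℕ∞ | ∃ (n : ℕ) (c : ℕ → X.H), c 0 = h ∧ c n = h' ∧
    (∀ i ≤ n, c i ∈ X.WSet γ) ∧ X.CChain c n ∧ e = n}

/-- Two 0-simplices of `∂X` (represented by minimal UBSs) are adjacent in the
1-skeleton of `∂X`. -/
def BAdj (U V : Set X.H) : Prop :=
  X.MinUBS U ∧ X.MinUBS V ∧ ¬ X.AlmostEq U V ∧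
    ∃ W, X.IsUBS W ∧ X.FaceOf U W ∧ X.FaceOf V W

/-- Distance in the 1-skeleton of the simplicial boundary `∂X`, between the
0-simplices represented by the minimal UBSs `U` and `V`. -/
noncomputable def bdist (U V : Set X.H) : ℕ∞ :=
  sInf {e : ℕ∞ | ∃ (n : ℕ) (c : ℕ → Set X.H),
    X.AlmostEq (c 0) U ∧ X.AlmostEq (c n) V ∧ (∀ i ≤ n, X.MinUBS (c i)) ∧
    (∀ i < n, X.BAdj (c i) (c (i+1)) ∨ X.AlmostEq (c i) (c (i+1))) ∧ e = n}

/-- Diameter of the contact graph. -/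
noncomputable def cdiam : ℕ∞ := ⨆ (h : X.H) (h' : X.H), X.cdist h h'

/-- Diameter of the crossing graph. -/
noncomputable def xdiam : ℕ∞ := ⨆ (h : X.H) (h' : X.H), X.xdist h h'

/-- Diameter of the 1-skeleton of the simplicial boundary. -/
noncomputable def bdiam : ℕ∞ :=
  ⨆ (U : Set X.H) (V : Set X.H) (_ : X.MinUBS U) (_ : X.MinUBS V), X.bdist U V

/-- A consistent orientation of the hyperplanes: any two chosen halfspaces
intersect. -/
def Consistent (χ : X.H → Bool) : Prop :=
  ∀ h h', ∃ x, X.side h x = χ h ∧ X.side h' x = χ h'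

/-- The halfspace `b` of `h`, as a set of 0-cubes. -/
def Hs (h : X.H) (b : Bool) : Set X.V := {x | X.side h x = b}

/-- Every simplex of `∂X` is visible, i.e. represented by the set of
hyperplanes crossing some combinatorial geodesic ray. -/
def FullyVisible : Prop :=
  ∀ V, X.IsUBS V → ∃ γ : ℕ → X.V, X.IsGeodesicRay γ ∧ X.AlmostEq (X.WSet γ) V

/-- The halfspace `b` of `h` is shallow: it lies within uniformly bounded
distance of the carrier of `h`. -/
def ShallowHalf (h : X.H) (b : Bool) : Prop :=
  ∃ R : ℕ, ∀ x, X.side h x = b → ∃ y ∈ X.carrier h, X.dist x y ≤ R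

/-- An `r`-avoiding combinatorial path (with respect to the basepoint `x₀`)
of length `n` from `a` to `b`. -/
def AvoidPathLen (x₀ : X.V) (r : ℕ) (a b : X.V) (n : ℕ) : Prop :=
  ∃ c : ℕ → X.V, c 0 = a ∧ c n = b ∧
    (∀ i < n, X.Adj (c i) (c (i+1))) ∧ ∀ i ≤ n, r ≤ X.dist (c i) x₀

/-- Combinatorial geodesic completeness: for every (finite) maximal family of
pairwise-crossing hyperplanes and every choice of halfspaces, the intersection
of the chosen halfspaces contains 0-cubes arbitrarily far from the
intersection of the carriers. -/
def CombGeodComplete : Prop :=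
  ∀ (n : ℕ) (W : Fin n → X.H), Function.Injective W →
    (∀ i j, i ≠ j → X.Crosses (W i) (W j)) →
    (∀ h, ¬ ∀ i, X.Crosses h (W i)) →
    ∀ χ : Fin n → Bool, ∀ R : ℕ,
      ∃ x, (∀ i, X.side (W i) x = χ i) ∧
        ∀ y, (∀ i, y ∈ X.carrier (W i)) → R ≤ X.dist x y

/-- `X` decomposes as a product of two unbounded convex subcomplexes:
equivalently, the hyperplanes split into two parts, each member of one part
crossing each member of the other, both factors being unbounded. -/
def ProductDecomp : Prop :=
  ∃ H₁ H₂ : Set X.H, Disjoint H₁ H₂ ∧ H₁ ∪ H₂ = Set.univ ∧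
    (∀ h₁ ∈ H₁, ∀ h₂ ∈ H₂, X.Crosses h₁ h₂) ∧
    (∀ n : ℕ, ∃ x y : X.V, n ≤ ({h | X.side h x ≠ X.side h y} ∩ H₁).ncard) ∧
    (∀ n : ℕ, ∃ x y : X.V, n ≤ ({h | X.side h x ≠ X.side h y} ∩ H₂).ncard)

/-- `∂X` decomposes as the simplicial join of two disjoint nonempty
subcomplexes: the 0-simplices split into two nonempty parts, any 0-simplex of
one part spanning a 1-simplex with any 0-simplex of the other. -/
def JoinDecomp : Prop :=
  ∃ 𝒜₁ 𝒜₂ : Set (Set X.H),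
    (∀ U ∈ 𝒜₁, X.MinUBS U) ∧ (∀ U ∈ 𝒜₂, X.MinUBS U) ∧
    𝒜₁.Nonempty ∧ 𝒜₂.Nonempty ∧
    (∀ U U', U ∈ 𝒜₁ → X.MinUBS U' → X.AlmostEq U U' → U' ∈ 𝒜₁) ∧
    (∀ U U', U ∈ 𝒜₂ → X.MinUBS U' → X.AlmostEq U U' → U' ∈ 𝒜₂) ∧
    (∀ U, X.MinUBS U → U ∈ 𝒜₁ ∨ U ∈ 𝒜₂) ∧
    (∀ U ∈ 𝒜₁, ∀ V ∈ 𝒜₂, ¬ X.AlmostEq U V) ∧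
    (∀ U ∈ 𝒜₁, ∀ V ∈ 𝒜₂, ∃ W, X.IsUBS W ∧ X.FaceOf U W ∧ X.FaceOf V W)

/-! Relative versions of the hyperplane notions, for a (convex) subcomplex
with 0-cube set `S`; the hyperplanes of the subcomplex are the hyperplanes of
`X` crossing it. -/

/-- `h` crosses the subcomplex with 0-cubes `S`. -/
def CrossesSet (S : Set X.V) (h : X.H) : Prop :=
  ∃ x ∈ S, ∃ y ∈ S, X.side h x ≠ X.side h y

def InHalfOn (S : Set X.V) (h' h : X.H) (b : Bool) : Prop :=
  h' ≠ h ∧ ∃ c : Bool, ∀ x ∈ S, X.side h x = !b → X.side h' x = c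

def SepHOn (S : Set X.V) (h h₁ h₂ : X.H) : Prop :=
  X.CrossesSet S h ∧ ∃ b : Bool, X.InHalfOn S h₁ h b ∧ X.InHalfOn S h₂ h (!b)

def InseparableOn (S : Set X.V) (U : Set X.H) : Prop :=
  ∀ u ∈ U, ∀ u' ∈ U, ∀ h, X.SepHOn S h u u' → h ∈ U

def UnidirectionalOn (S : Set X.V) (U : Set X.H) : Prop :=
  ∀ u ∈ U, ∃ b : Bool, {h | h ∈ U ∧ X.InHalfOn S h u b}.Finite

def NoFacingTripleOn (S : Set X.V) (U : Set X.H) : Prop :=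
  ∀ h₁ ∈ U, ∀ h₂ ∈ U, ∀ h₃ ∈ U, ¬ (h₁ ≠ h₂ ∧ h₁ ≠ h₃ ∧ h₂ ≠ h₃ ∧
    ∃ b₁ b₂ b₃ : Bool,
      X.InHalfOn S h₂ h₁ b₁ ∧ X.InHalfOn S h₃ h₁ b₁ ∧
      X.InHalfOn S h₁ h₂ b₂ ∧ X.InHalfOn S h₃ h₂ b₂ ∧
      X.InHalfOn S h₁ h₃ b₃ ∧ X.InHalfOn S h₂ h₃ b₃)

/-- A UBS of the subcomplex with 0-cube set `S`. -/
def IsUBSOn (S : Set X.V) (U : Set X.H) : Prop :=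
  (∀ h ∈ U, X.CrossesSet S h) ∧ U.Infinite ∧ X.InseparableOn S U ∧
    X.UnidirectionalOn S U ∧ X.NoFacingTripleOn S U

def MinUBSOn (S : Set X.V) (U : Set X.H) : Prop :=
  X.IsUBSOn S U ∧ ∀ U' ⊆ U, X.IsUBSOn S U' → X.AlmostEq U U'

def FaceOfOn (S : Set X.V) (U V : Set X.H) : Prop :=
  ∃ U' V', X.IsUBSOn S U' ∧ X.IsUBSOn S V' ∧ X.AlmostEq U U' ∧ X.AlmostEq V V' ∧ U' ⊆ V'

def HasDimOn (S : Set X.V) (U : Set X.H) (k : ℕ) : Prop :=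
  ∃ 𝒰 : Fin k → Set X.H, (∀ i, X.MinUBSOn S (𝒰 i)) ∧
    (∀ i j, i ≠ j → Disjoint (𝒰 i) (𝒰 j)) ∧ X.AlmostEq U (⋃ i, 𝒰 i)

end CCC

namespace CCC

variable {X : CCC} {o : X.V}

/-! ### The order on hyperplanes seen from a base 0-cube -/

/-- The hyperplanes separating `x` from `y`. -/
def sep (x y : X.V) : Set X.H := {h | X.side h x ≠ X.side h y}

/-- Seen from `o`, the hyperplane `h` comes before `h'`: the halfspace of `h'` missing `o` is
contained in the halfspace of `h` missing `o`. -/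
def FarLe (o : X.V) (h h' : X.H) : Prop := ∀ x, h' ∈ sep o x → h ∈ sep o x

/-- The halfspaces of `h` and `h'` missing `o` intersect. -/
def FarMeet (o : X.V) (h h' : X.H) : Prop := ∃ x, h ∈ sep o x ∧ h' ∈ sep o x

/-- Lower sets for `FarLe o` all of whose members have intersecting far halfspaces. The finite
ones are the sets of hyperplanes separating `o` from a 0-cube. -/
structure IsIdeal (o : X.V) (D : Set X.H) : Prop where
  lower : ∀ h ∈ D, ∀ h', FarLe o h' h → h' ∈ D
  meet : ∀ h ∈ D, ∀ k ∈ D, FarMeet o h k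

/-- The lower closure of `S` for `FarLe o`. -/
def lowerHull (o : X.V) (S : Set X.H) : Set X.H := {h | ∃ s ∈ S, FarLe o h s}

/-- The number of hyperplanes weakly preceding `h` seen from `o`. -/
noncomputable def height (o : X.V) (h : X.H) : ℕ := {h' | FarLe o h' h}.ncard

theorem mem_sep {x y : X.V} {h : X.H} : h ∈ sep x y ↔ X.side h y = !X.side h x := by
  unfold sep
  cases hx : X.side h x <;> cases hy : X.side h y <;> simp [hx, hy]

theorem notMem_sep {x y : X.V} {h : X.H} : h ∉ sep x y ↔ X.side h y = X.side h x := by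
  unfold sep
  simp [eq_comm]

theorem sep_comm (x y : X.V) : sep x y = sep y x := by
  ext h
  simp [sep, ne_comm]

theorem finite_sep (x y : X.V) : (sep x y).Finite := X.sep_finite x y

theorem dist_eq_ncard (x y : X.V) : X.dist x y = (sep x y).ncard :=
  (Set.ncard_eq_toFinset_card _ (X.sep_finite x y)).symm

theorem dist_comm (x y : X.V) : X.dist x y = X.dist y x := by
  rw [dist_eq_ncard, dist_eq_ncard, sep_comm]

theorem sep_subset_union (x y z : X.V) : sep x z ⊆ sep x y ∪ sep y z := by
  intro h hh
  by_contra hc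
  rw [Set.mem_union, not_or, notMem_sep, notMem_sep] at hc
  exact notMem_sep.2 (hc.2.trans hc.1) hh

theorem dist_triangle (x y z : X.V) : X.dist x z ≤ X.dist x y + X.dist y z := by
  simp only [dist_eq_ncard]
  exact (Set.ncard_le_ncard (sep_subset_union x y z)
    ((finite_sep _ _).union (finite_sep _ _))).trans (Set.ncard_union_le _ _)

theorem eq_of_sep_eq {x y : X.V} (h : sep o x = sep o y) : x = y := by
  refine X.vertex_ext x y fun k => ?_
  by_cases hk : k ∈ sep o x
  · rw [mem_sep.1 hk, mem_sep.1 (show k ∈ sep o y from h ▸ hk)]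
  · rw [notMem_sep.1 hk, notMem_sep.1 (show k ∉ sep o y from h ▸ hk)]

theorem exists_mem_sep (o : X.V) (h : X.H) : ∃ x, h ∈ sep o x := by
  obtain ⟨x, hx⟩ := X.halfspace_nonempty h (!X.side h o)
  exact ⟨x, mem_sep.2 hx⟩

theorem FarLe.refl (h : X.H) : FarLe o h h := fun _ hx => hx

theorem FarLe.trans {h₁ h₂ h₃ : X.H} (h : FarLe o h₁ h₂) (h' : FarLe o h₂ h₃) :
    FarLe o h₁ h₃ := fun x hx => h x (h' x hx)

instance : IsTrans X.H (FarLe o) := ⟨fun _ _ _ => FarLe.trans⟩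

theorem FarLe.antisymm {h h' : X.H} (h₁ : FarLe o h h') (h₂ : FarLe o h' h) : h = h' := by
  have key : ∀ x, h ∈ sep o x ↔ h' ∈ sep o x := fun x => ⟨h₂ x, h₁ x⟩
  by_cases ho : X.side h o = X.side h' o
  · refine X.hyp_inj h h' fun x => ?_
    by_cases hx : h ∈ sep o x
    · rw [mem_sep.1 hx, mem_sep.1 ((key x).1 hx), ho]
    · rw [notMem_sep.1 hx, notMem_sep.1 (mt (key x).2 hx), ho]
  · have ho' : X.side h o = !X.side h' o := by
      cases h₁ : X.side h o <;> cases h₂ : X.side h' o <;> simp_all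
    refine X.hyp_inj' h h' fun x => ?_
    by_cases hx : h ∈ sep o x
    · rw [mem_sep.1 hx, mem_sep.1 ((key x).1 hx), ho']
    · rw [notMem_sep.1 hx, notMem_sep.1 (mt (key x).2 hx), ho']

theorem finite_setOf_farLe (o : X.V) (h : X.H) : {h' | FarLe o h' h}.Finite := by
  obtain ⟨x, hx⟩ := exists_mem_sep o h
  exact (finite_sep o x).subset fun h' hh' => hh' x hx

theorem height_lt {h h' : X.H} (hle : FarLe o h h') (hne : h ≠ h') :
    height o h < height o h' :=
  Set.ncard_lt_ncard (Set.ssubset_iff_exists.2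
    ⟨fun _ hk => FarLe.trans hk hle, h', FarLe.refl h', fun hk => hne (hle.antisymm hk)⟩)
    (finite_setOf_farLe o h')

theorem exists_minimal {S : Set X.H} (hS : S.Nonempty) (o : X.V) :
    ∃ h ∈ S, ∀ h', FarLe o h' h → h' ≠ h → h' ∉ S := by
  obtain ⟨h, hh, hmin⟩ := (InvImage.wf (height o) wellFounded_lt).has_min S hS
  exact ⟨h, hh, fun h' hle hne hS => hmin h' hS (height_lt hle hne)⟩

/-! ### Ideals and 0-cubes -/

theorem isIdeal_sep (o x : X.V) : IsIdeal o (sep o x) :=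
  ⟨fun _ hh _ hle => hle x hh, fun _ hh _ hh' => ⟨x, hh, hh'⟩⟩

theorem IsIdeal.exists_sep_eq {D : Set X.H} (hD : IsIdeal o D) (hfin : D.Finite) :
    ∃ x, sep o x = D := by
  classical
  have far : ∀ h ∈ D, ∀ h' ∉ D, ∃ y, X.side h y = !X.side h o ∧ X.side h' y = X.side h' o := by
    intro h hh h' hh'
    by_contra hc
    refine hh' (hD.lower h hh h' fun x hx => ?_)
    by_contra hx'
    exact hc ⟨x, mem_sep.1 hx, notMem_sep.1 hx'⟩
  obtain ⟨y, hy⟩ := X.realize (fun h => if h ∈ D then !X.side h o else X.side h o) o (by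
    intro h h'
    by_cases hh : h ∈ D <;> by_cases hh' : h' ∈ D <;> simp only [hh, hh', if_true, if_false]
    · obtain ⟨y, hy, hy'⟩ := hD.meet h hh h' hh'
      exact ⟨y, mem_sep.1 hy, mem_sep.1 hy'⟩
    · exact far h hh h' hh'
    · obtain ⟨y, hy, hy'⟩ := far h' hh' h hh
      exact ⟨y, hy', hy⟩
    · exact ⟨o, rfl, rfl⟩) (hfin.subset fun h hh => by
      by_contra hc
      simp [hc] at hh)
  refine ⟨y, Set.ext fun h => ?_⟩
  rw [mem_sep, hy h]
  by_cases hh : h ∈ D <;> simp [hh]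

theorem IsIdeal.mono_meet {D D' : Set X.H} (hD : IsIdeal o D) (hsub : D' ⊆ D)
    (hlow : ∀ h ∈ D', ∀ h', FarLe o h' h → h' ∈ D') : IsIdeal o D' :=
  ⟨hlow, fun h hh h' hh' => hD.meet h (hsub hh) h' (hsub hh')⟩

theorem IsIdeal.inter {D D' : Set X.H} (hD : IsIdeal o D) (hD' : IsIdeal o D') :
    IsIdeal o (D ∩ D') :=
  hD.mono_meet Set.inter_subset_left fun h hh h' hle =>
    ⟨hD.lower h hh.1 h' hle, hD'.lower h hh.2 h' hle⟩

theorem IsIdeal.union {D P Q : Set X.H} (hD : IsIdeal o D) (hP : IsIdeal o P) (hQ : IsIdeal o Q)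
    (hPD : P ⊆ D) (hQD : Q ⊆ D) : IsIdeal o (P ∪ Q) :=
  hD.mono_meet (Set.union_subset hPD hQD) fun h hh h' hle =>
    hh.imp (fun hh => hP.lower h hh h' hle) fun hh => hQ.lower h hh h' hle

/-- A proper subideal can be enlarged by one hyperplane. -/
theorem IsIdeal.exists_insert {D P : Set X.H} (hD : IsIdeal o D) (hP : IsIdeal o P)
    (hPD : P ⊂ D) : ∃ h ∈ D, h ∉ P ∧ IsIdeal o (insert h P) := by
  obtain ⟨h, ⟨hhD, hhP⟩, hmin⟩ := exists_minimal (Set.nonempty_of_ssubset hPD) o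
  refine ⟨h, hhD, hhP, hD.mono_meet (Set.insert_subset hhD hPD.subset) ?_⟩
  rintro k (rfl | hk) h' hle
  · by_cases hne : h' = k
    · exact Or.inl hne
    · refine Or.inr ?_
      by_contra hc
      exact hmin h' hle hne ⟨hD.lower k hhD h' hle, hc⟩
  · exact Or.inr (hP.lower k hk h' hle)

theorem adj_of_sep_eq_insert {x y : X.V} {h : X.H} (hx : h ∉ sep o x)
    (hy : sep o y = insert h (sep o x)) : X.Adj x y := by
  have hyh : h ∈ sep o y := hy ▸ Set.mem_insert _ _
  refine ⟨h, ?_, fun k hk => ?_⟩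
  · rw [notMem_sep.1 hx, mem_sep.1 hyh]
    simp
  · by_contra hne
    by_cases hkx : k ∈ sep o x
    · have hky : k ∈ sep o y := hy ▸ Set.mem_insert_of_mem _ hkx
      exact hk (by rw [mem_sep.1 hkx, mem_sep.1 hky])
    · have hky : k ∉ sep o y := by
        rw [hy]
        rintro (h | h)
        exacts [hne h, hkx h]
      exact hk (by rw [notMem_sep.1 hkx, notMem_sep.1 hky])

/-- An ideal with at least `n` members contains the separating set of a 0-cube at distance `n`. -/
theorem IsIdeal.exists_dist_eq {D : Set X.H} (hD : IsIdeal o D) (n : ℕ)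
    (hn : D.Infinite ∨ n ≤ D.ncard) : ∃ x, sep o x ⊆ D ∧ X.dist o x = n := by
  induction n with
  | zero => exact ⟨o, fun h hh => absurd rfl hh, by rw [dist_eq_ncard]; simp [sep]⟩
  | succ n ih =>
    obtain ⟨x, hxD, hxn⟩ := ih (hn.imp id fun h => by omega)
    rw [dist_eq_ncard] at hxn
    have hss : sep o x ⊂ D := by
      refine hxD.ssubset_of_ne fun he => ?_
      rcases hn with hn | hn
      · exact hn (he ▸ finite_sep o x)
      · rw [← he] at hn
        omega
    obtain ⟨h, hhD, hhx, hid⟩ := hD.exists_insert (isIdeal_sep o x) hss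
    obtain ⟨y, hy⟩ := hid.exists_sep_eq ((finite_sep o x).insert h)
    refine ⟨y, hy ▸ Set.insert_subset hhD hxD, ?_⟩
    rw [dist_eq_ncard, hy, Set.ncard_insert_of_notMem hhx (finite_sep o x), hxn]

theorem finite_sphere (hlf : X.LocallyFinite) (o : X.V) (n : ℕ) :
    {x | X.dist o x = n}.Finite := by
  induction n with
  | zero =>
    refine (Set.finite_singleton o).subset fun x hx => ?_
    rw [Set.mem_ofPred_eq, dist_eq_ncard, Set.ncard_eq_zero (finite_sep o x)] at hx
    refine eq_of_sep_eq (o := o) (hx.trans ?_)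
    simp [sep]
  | succ n ih =>
    refine (ih.biUnion fun z _ => hlf z).subset fun x hx => ?_
    obtain ⟨z, hzx, hz⟩ := (isIdeal_sep o x).exists_dist_eq n
      (Or.inr (by rw [← dist_eq_ncard, hx]; omega))
    rw [Set.mem_ofPred_eq, dist_eq_ncard] at hx
    have hzn := hz
    rw [dist_eq_ncard] at hzn
    obtain ⟨h, hhx, hhz, -⟩ := (isIdeal_sep o x).exists_insert (isIdeal_sep o z)
      (hzx.ssubset_of_ne fun he => by rw [he] at hzn; omega)
    refine Set.mem_biUnion (show z ∈ {x | X.dist o x = n} from hz)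
      (adj_of_sep_eq_insert hhz (Set.eq_of_subset_of_ncard_le
        (Set.insert_subset hhx hzx) ?_ (finite_sep o x)).symm)
    rw [Set.ncard_insert_of_notMem hhz (finite_sep o z), hx, hzn]

/-! ### Avoiding paths -/

theorem AvoidPathLen.refl {r : ℕ} {x : X.V} (hx : r ≤ X.dist o x) : X.AvoidPathLen o r x x 0 :=
  ⟨fun _ => x, rfl, rfl, fun i hi => absurd hi (Nat.not_lt_zero i),
    fun _ _ => by rwa [dist_comm]⟩

theorem Adj.symm {x y : X.V} (h : X.Adj x y) : X.Adj y x := by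
  obtain ⟨k, hk, hu⟩ := h
  exact ⟨k, hk.symm, fun k' hk' => hu k' hk'.symm⟩

theorem AvoidPathLen.trans {r m n : ℕ} {x y z : X.V} (h₁ : X.AvoidPathLen o r x y m)
    (h₂ : X.AvoidPathLen o r y z n) : X.AvoidPathLen o r x z (m + n) := by
  obtain ⟨c, rfl, hc, hca, hcr⟩ := h₁
  obtain ⟨d, hd, rfl, hda, hdr⟩ := h₂
  refine ⟨fun i => if i ≤ m then c i else d (i - m), by simp, ?_, fun i hi => ?_, fun i hi => ?_⟩
  · by_cases hn : n = 0
    · simp [hn, hc, hd]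
    · simp [hn]
  · rcases lt_trichotomy i m with him | rfl | him
    · simpa [him.le, Nat.succ_le_of_lt him] using hca i him
    · have := hda 0 (by omega)
      simpa [hc, ← hd] using this
    · have := hda (i - m) (by omega)
      rw [show i - m + 1 = i + 1 - m by omega] at this
      simpa [not_le.2 him, not_le.2 (him.trans (Nat.lt_succ_self i))] using this
  · by_cases him : i ≤ m
    · simpa [him] using hcr i him
    · simpa [him] using hdr (i - m) (by omega)

theorem AvoidPathLen.symm {r n : ℕ} {x y : X.V} (h : X.AvoidPathLen o r x y n) :
    X.AvoidPathLen o r y x n := by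
  obtain ⟨c, rfl, rfl, hca, hcr⟩ := h
  refine ⟨fun i => c (n - i), by simp, by simp, fun i hi => ?_, fun i _ => hcr _ (by omega)⟩
  have := (hca (n - (i + 1)) (by omega)).symm
  rwa [show n - (i + 1) + 1 = n - i by omega] at this

theorem avoidPathLen_of_sep_subset {r : ℕ} {x y : X.V} (hx : r ≤ X.dist o x)
    (hxy : sep o x ⊆ sep o y) : X.AvoidPathLen o r x y (X.dist o y - X.dist o x) := by
  generalize hn : X.dist o y - X.dist o x = n
  induction n generalizing x with
  | zero =>
    rw [dist_eq_ncard, dist_eq_ncard] at hn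
    have := eq_of_sep_eq (Set.eq_of_subset_of_ncard_le hxy (by omega) (finite_sep o y))
    subst this
    exact AvoidPathLen.refl hx
  | succ n ih =>
    obtain ⟨h, hhy, hhx, hid⟩ := (isIdeal_sep o y).exists_insert (isIdeal_sep o x)
      (hxy.ssubset_of_ne fun he => by simp [dist_eq_ncard, he] at hn)
    obtain ⟨z, hz⟩ := hid.exists_sep_eq ((finite_sep o x).insert h)
    have hzd : X.dist o z = X.dist o x + 1 := by
      rw [dist_eq_ncard, hz, Set.ncard_insert_of_notMem hhx (finite_sep o x), dist_eq_ncard]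
    have step : X.AvoidPathLen o r x z 1 := by
      refine ⟨fun i => if i = 0 then x else z, by simp, by simp, fun i hi => ?_, fun i _ => ?_⟩
      · obtain rfl : i = 0 := by omega
        simpa using adj_of_sep_eq_insert hhx hz
      · by_cases hi : i = 0
        · simpa [hi, dist_comm x] using hx
        · simp only [hi, if_false, dist_comm z]
          omega
    rw [add_comm]
    exact step.trans (ih (by omega) (hz ▸ Set.insert_subset hhy hxy) (by omega))

/-- Two 0-cubes on a sphere whose separating sets lie in a common ideal are joined by a short path
outside the corresponding ball. -/
theorem IsIdeal.exists_avoidPathLen {D : Set X.H} (hD : IsIdeal o D) {r : ℕ} {x y : X.V}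
    (hxD : sep o x ⊆ D) (hyD : sep o y ⊆ D) (hx : X.dist o x = r) (hy : X.dist o y = r) :
    ∃ n ≤ 2 * r, X.AvoidPathLen o r x y n := by
  obtain ⟨z, hz⟩ := (hD.union (isIdeal_sep o x) (isIdeal_sep o y) hxD hyD).exists_sep_eq
    ((finite_sep o x).union (finite_sep o y))
  have hzr : X.dist o z ≤ r + r := by
    have := Set.ncard_union_le (sep o x) (sep o y)
    rwa [← hz, ← dist_eq_ncard, ← dist_eq_ncard, ← dist_eq_ncard, hx, hy] at this
  refine ⟨_, ?_, (avoidPathLen_of_sep_subset hx.ge (hz ▸ Set.subset_union_left)).trans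
    (avoidPathLen_of_sep_subset hy.ge (hz ▸ Set.subset_union_right)).symm⟩
  omega

/-! ### Ideals and unidirectional boundary sets -/

theorem inHalf_far {h u : X.H} (hle : FarLe o u h) (hne : h ≠ u) :
    X.InHalf h u (!X.side u o) :=
  ⟨hne, X.side h o, fun x hx => notMem_sep.1 fun hh => by
    have := mem_sep.1 (hle x hh)
    rw [hx] at this
    cases hu : X.side u o <;> simp [hu] at this⟩

theorem inHalf_near {h u : X.H} (hle : FarLe o h u) (hne : h ≠ u) :
    X.InHalf h u (X.side u o) :=
  ⟨hne, !X.side h o, fun x hx => mem_sep.1 (hle x (mem_sep.2 hx))⟩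

theorem inHalf_near_of_not_farMeet {h u : X.H} (hm : ¬ FarMeet o h u) :
    X.InHalf h u (X.side u o) := by
  refine ⟨?_, X.side h o, fun x hx => notMem_sep.1 fun hh => hm ⟨x, hh, mem_sep.2 hx⟩⟩
  rintro rfl
  obtain ⟨x, hx⟩ := exists_mem_sep o h
  exact hm ⟨x, hx, hx⟩

theorem InHalf.farLe_of_far {h u : X.H} (hu : X.InHalf h u (!X.side u o)) : FarLe o u h := by
  obtain ⟨-, c, hc⟩ := hu
  intro x hx
  by_contra hux
  have h₁ := hc x (by rw [notMem_sep.1 hux, Bool.not_not])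
  have h₂ := hc o (by rw [Bool.not_not])
  exact hx (h₂.trans h₁.symm)

theorem InHalf.farLe_of_near {h u : X.H} (hm : FarMeet o h u) (hu : X.InHalf h u (X.side u o)) :
    FarLe o h u := by
  obtain ⟨-, c, hc⟩ := hu
  obtain ⟨y, hy, hy'⟩ := hm
  intro x hx
  rw [mem_sep, hc x (mem_sep.1 hx), ← hc y (mem_sep.1 hy'), mem_sep.1 hy]

theorem FarMeet.symm {h h' : X.H} (hm : FarMeet o h h') : FarMeet o h' h :=
  hm.imp fun _ h => h.symm

theorem FarMeet.mono {h h' k k' : X.H} (hm : FarMeet o k k') (hk : FarLe o h k)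
    (hk' : FarLe o h' k') : FarMeet o h h' :=
  hm.imp fun x hx => ⟨hk x hx.1, hk' x hx.2⟩

theorem crosses_of_not_farLe {h h' : X.H} (hm : FarMeet o h h') (h₁ : ¬ FarLe o h h')
    (h₂ : ¬ FarLe o h' h) : X.Crosses h h' := by
  unfold FarLe at h₁ h₂
  push Not at h₁ h₂
  obtain ⟨x, hx, hx'⟩ := hm
  obtain ⟨y, hy, hy'⟩ := h₁
  obtain ⟨z, hz, hz'⟩ := h₂
  rw [mem_sep] at hx hx' hy hz
  rw [notMem_sep] at hy' hz'
  intro b b'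
  rcases Bool.eq_or_eq_not b (X.side h o) with rfl | rfl <;>
    rcases Bool.eq_or_eq_not b' (X.side h' o) with rfl | rfl
  exacts [⟨o, rfl, rfl⟩, ⟨y, hy', hy⟩, ⟨z, hz, hz'⟩, ⟨x, hx, hx'⟩]

theorem IsIdeal.inseparable {D : Set X.H} (hD : IsIdeal o D) : X.Inseparable D := by
  rintro u hu u' hu' h ⟨b, hb, hb'⟩
  rcases Bool.eq_or_eq_not b (X.side h o) with rfl | rfl
  · exact hD.lower u' hu' h hb'.farLe_of_far
  · exact hD.lower u hu h hb.farLe_of_far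

theorem IsIdeal.unidirectional {D : Set X.H} (hD : IsIdeal o D) : X.Unidirectional D :=
  fun u hu => ⟨X.side u o, (finite_setOf_farLe o u).subset fun h hh =>
    hh.2.farLe_of_near (hD.meet h hh.1 u hu)⟩

theorem IsIdeal.noFacingTriple {D : Set X.H} (hD : IsIdeal o D) : X.NoFacingTriple D := by
  rintro h₁ m₁ h₂ m₂ h₃ m₃ ⟨n₁₂, n₁₃, n₂₃, b₁, b₂, b₃, a₂, a₃, c₁, c₃, d₁, d₂⟩
  have key : ∀ h ∈ D, ∀ k ∈ D, ∀ l ∈ D, ∀ b, X.InHalf k h b → X.InHalf l h b →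
      (FarLe o k h ∧ FarLe o l h) ∨ (FarLe o h k ∧ FarLe o h l) := by
    intro h hh k hk l hl b hb hb'
    rcases Bool.eq_or_eq_not b (X.side h o) with rfl | rfl
    · exact Or.inl ⟨hb.farLe_of_near (hD.meet k hk h hh), hb'.farLe_of_near (hD.meet l hl h hh)⟩
    · exact Or.inr ⟨hb.farLe_of_far, hb'.farLe_of_far⟩
  rcases key h₁ m₁ h₂ m₂ h₃ m₃ b₁ a₂ a₃ with e₁ | e₁ <;>
    rcases key h₂ m₂ h₁ m₁ h₃ m₃ b₂ c₁ c₃ with e₂ | e₂ <;>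
    rcases key h₃ m₃ h₁ m₁ h₂ m₂ b₃ d₁ d₂ with e₃ | e₃
  · exact n₁₂ (e₂.1.antisymm e₁.1)
  · exact n₁₂ (e₂.1.antisymm e₁.1)
  · exact n₁₃ (e₃.1.antisymm e₁.2)
  · exact n₂₃ (e₂.2.antisymm e₃.2)
  · exact n₂₃ (e₃.2.antisymm e₂.2)
  · exact n₁₃ (e₁.2.antisymm e₃.1)
  · exact n₁₂ (e₁.1.antisymm e₂.1)
  · exact n₁₂ (e₁.1.antisymm e₂.1)

theorem IsIdeal.isUBS {D : Set X.H} (hD : IsIdeal o D) (hinf : D.Infinite) : X.IsUBS D :=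
  ⟨hinf, hD.inseparable, hD.unidirectional, hD.noFacingTriple⟩

theorem NoFacingTriple.mono {S T : Set X.H} (hT : X.NoFacingTriple T) (h : S ⊆ T) :
    X.NoFacingTriple S :=
  fun h₁ m₁ h₂ m₂ h₃ m₃ => hT h₁ (h m₁) h₂ (h m₂) h₃ (h m₃)

theorem facingTriple_of_not_farMeet {h₁ h₂ h₃ : X.H} (h₁₂ : ¬ FarMeet o h₁ h₂)
    (h₁₃ : ¬ FarMeet o h₁ h₃) (h₂₃ : ¬ FarMeet o h₂ h₃) : X.FacingTriple h₁ h₂ h₃ := by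
  have h₂₁ := mt FarMeet.symm h₁₂
  have h₃₁ := mt FarMeet.symm h₁₃
  have h₃₂ := mt FarMeet.symm h₂₃
  exact ⟨(inHalf_near_of_not_farMeet h₁₂).1, (inHalf_near_of_not_farMeet h₁₃).1,
    (inHalf_near_of_not_farMeet h₂₃).1, X.side h₁ o, X.side h₂ o, X.side h₃ o,
    inHalf_near_of_not_farMeet h₂₁, inHalf_near_of_not_farMeet h₃₁,
    inHalf_near_of_not_farMeet h₁₂, inHalf_near_of_not_farMeet h₃₂,
    inHalf_near_of_not_farMeet h₁₃, inHalf_near_of_not_farMeet h₂₃⟩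

/-- Antichains without facing triples are finite. -/
theorem finite_of_antichain (hnc : X.NoInfiniteCrossing) {S : Set X.H}
    (hnft : X.NoFacingTriple S) (hS : ∀ h ∈ S, ∀ h' ∈ S, h ≠ h' → ¬ FarLe o h h') :
    S.Finite := by
  have cross : ∀ T ⊆ S, (∀ h ∈ T, ∀ h' ∈ T, h ≠ h' → FarMeet o h h') → T.Finite :=
    fun T hT hm => hnc T fun h hh h' hh' hne =>
      crosses_of_not_farLe (hm h hh h' hh' hne) (hS h (hT hh) h' (hT hh') hne)
        (hS h' (hT hh') h (hT hh) hne.symm)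
  obtain ⟨M, hM⟩ := zorn_subset {T | T ⊆ S ∧ T.Pairwise (FarMeet o)} fun c hc hchain =>
    ⟨⋃₀ c, ⟨Set.sUnion_subset fun T hT => (hc hT).1,
      (Set.pairwise_sUnion hchain.directedOn).2 fun T hT => (hc hT).2⟩,
      fun T hT => Set.subset_sUnion_of_mem hT⟩
  obtain ⟨⟨hMS, hMm⟩, hmax⟩ := hM
  have hMfin : M.Finite := cross M hMS fun h hh h' hh' hne => hMm hh hh' hne
  have hnbr : ∀ u ∈ S, {v ∈ S | ¬ FarMeet o u v}.Finite := by
    intro u hu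
    refine cross _ (Set.sep_subset _ _) fun h hh h' hh' _ => ?_
    by_contra hc
    exact hnft u hu h hh.1 h' hh'.1 (facingTriple_of_not_farMeet hh.2 hh'.2 hc)
  refine (hMfin.union (hMfin.biUnion fun u hu => hnbr u (hMS hu))).subset fun v hv => ?_
  by_contra hc
  rw [Set.mem_union, not_or] at hc
  have hall : ∀ u ∈ M, FarMeet o u v := fun u hu => by
    by_contra hm
    exact hc.2 (Set.mem_biUnion hu ⟨hv, hm⟩)
  refine hc.1 (hmax (y := insert v M) ⟨Set.insert_subset hv hMS, ?_⟩ (Set.subset_insert v M)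
    (Set.mem_insert v M))
  exact hMm.insert fun u hu _ => ⟨(hall u hu).symm, hall u hu⟩

/-- A sequence of distinct hyperplanes without facing triples has an increasing subsequence. -/
theorem exists_increasing_subseq (hnc : X.NoInfiniteCrossing) (o : X.V) {f : ℕ → X.H}
    (hf : f.Injective) (hnft : X.NoFacingTriple (Set.range f)) :
    ∃ g : ℕ ↪o ℕ, ∀ m n, m < n → FarLe o (f (g m)) (f (g n)) := by
  obtain ⟨g, hg | hg⟩ := exists_increasing_or_nonincreasing_subseq (FarLe o) f
  · exact ⟨g, hg⟩
  exfalso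
  obtain ⟨g', hg' | hg'⟩ :=
    exists_increasing_or_nonincreasing_subseq (Function.swap (FarLe o)) (f ∘ g)
  · refine Set.infinite_of_injective_forall_mem (f := fun n => f (g (g' n)))
      (fun m n h => g'.injective (g.injective (hf h))) (fun n => ?_)
      (finite_setOf_farLe o (f (g (g' 0))))
    rcases Nat.eq_zero_or_pos n with rfl | hn
    · exact FarLe.refl _
    · exact hg' 0 n hn
  · have hinj : Function.Injective fun n => f (g (g' n)) :=
      fun m n h => g'.injective (g.injective (hf h))
    refine Set.infinite_range_of_injective hinj (finite_of_antichain (o := o) hnc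
      (hnft.mono (by rintro _ ⟨n, rfl⟩; exact ⟨_, rfl⟩)) ?_)
    rintro _ ⟨m, rfl⟩ _ ⟨n, rfl⟩ hne
    rcases lt_trichotomy m n with h | rfl | h
    · exact hg _ _ (g'.lt_iff_lt.2 h)
    · exact absurd rfl hne
    · exact hg' _ _ h

/-- The members of `U` preceding infinitely many members of `U`. -/
def core (o : X.V) (U : Set X.H) : Set X.H := {u | u ∈ U ∧ {v | v ∈ U ∧ FarLe o u v}.Infinite}

theorem finite_diff_core (hnc : X.NoInfiniteCrossing) {U : Set X.H} (hU : X.NoFacingTriple U) :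
    (U \ core o U).Finite := by
  by_contra hinf
  let e := Set.Infinite.natEmbedding _ hinf
  have he : ∀ n, (e n : X.H) ∈ U \ core o U := fun n => (e n).2
  have hinj : Function.Injective fun n => (e n : X.H) := Subtype.val_injective.comp e.injective
  obtain ⟨g, hg⟩ := exists_increasing_subseq hnc o hinj
    (hU.mono (by rintro _ ⟨n, rfl⟩; exact (he n).1))
  refine (he (g 0)).2 ⟨(he (g 0)).1, Set.infinite_of_injective_forall_mem
    (hinj.comp g.injective) fun n => ⟨(he (g n)).1, ?_⟩⟩
  rcases Nat.eq_zero_or_pos n with rfl | hn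
  · exact FarLe.refl _
  · exact hg 0 n hn

theorem core_farMeet {U : Set X.H} (hU : X.Unidirectional U) {u v : X.H} (hu : u ∈ core o U)
    (hv : v ∈ core o U) : FarMeet o u v := by
  by_contra hm
  obtain ⟨b, hb⟩ := hU u hu.1
  rcases Bool.eq_or_eq_not b (X.side u o) with rfl | rfl
  · refine hv.2 (hb.subset fun w hw => ⟨hw.1, inHalf_near_of_not_farMeet fun hwu => ?_⟩)
    exact hm ((hwu.mono hw.2 (FarLe.refl u)).symm)
  · refine (hu.2.sdiff (Set.finite_singleton u)) (hb.subset fun w hw => ⟨hw.1.1, ?_⟩)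
    exact inHalf_far hw.1.2 hw.2

/-- The ideal generated by the core of a UBS. -/
theorem IsUBS.isIdeal_lowerHull {U : Set X.H} (hU : X.IsUBS U) (o : X.V) :
    IsIdeal o (lowerHull o (core o U)) :=
  ⟨fun _ ⟨s, hs, hle⟩ _ hle' => ⟨s, hs, hle'.trans hle⟩,
    fun _ ⟨_, hs, hle⟩ _ ⟨_, hs', hle'⟩ => (core_farMeet hU.2.2.1 hs hs').mono hle hle'⟩

theorem subset_lowerHull (S : Set X.H) : S ⊆ lowerHull o S := fun s hs => ⟨s, hs, FarLe.refl s⟩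

/-- An infinite ideal contains a minimal infinite ideal. -/
theorem IsIdeal.exists_minimal_ideal (hnc : X.NoInfiniteCrossing) {D : Set X.H}
    (hD : IsIdeal o D) (hinf : D.Infinite) :
    ∃ E ⊆ D, IsIdeal o E ∧ E.Infinite ∧ ∀ E' ⊂ E, IsIdeal o E' → E'.Finite := by
  by_contra! hc
  let T := {E : Set X.H // E ⊆ D ∧ IsIdeal o E ∧ E.Infinite}
  have next : ∀ E : T, ∃ E' : T, E'.1 ⊂ E.1 := fun E => by
    obtain ⟨E', hss, hid, hi⟩ := hc E.1 E.2.1 E.2.2.1 E.2.2.2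
    exact ⟨⟨E', hss.subset.trans E.2.1, hid, hi⟩, hss⟩
  choose nx hnx using next
  let s : ℕ → T := fun n => nx^[n] ⟨D, subset_rfl, hD, hinf⟩
  have hs : ∀ n, (s (n + 1)).1 ⊂ (s n).1 := fun n => by
    simp only [s, Function.iterate_succ_apply']
    exact hnx _
  have hanti : ∀ m n, m ≤ n → (s n).1 ⊆ (s m).1 := fun m n hmn =>
    antitone_nat_of_succ_le (f := fun n => (s n).1) (fun n => (hs n).subset) hmn
  choose f hf hf' using fun n => Set.exists_of_ssubset (hs n)
  have hlt : ∀ m n, m < n → ¬ FarLe o (f m) (f n) := fun m n hmn hle =>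
    hf' m ((s (m + 1)).2.2.1.lower _ (hanti _ _ hmn (hf n)) _ hle)
  have hinj : Function.Injective f := fun m n h => by
    rcases lt_trichotomy m n with h' | h' | h'
    · exact absurd (h ▸ FarLe.refl _) (hlt m n h')
    · exact h'
    · exact absurd (h ▸ FarLe.refl _) (hlt n m h')
  obtain ⟨g, hg⟩ := exists_increasing_subseq hnc o hinj
    (hD.noFacingTriple.mono (by rintro _ ⟨n, rfl⟩; exact (s n).2.1 (hf n)))
  exact hlt _ _ (g.lt_iff_lt.2 zero_lt_one) (hg 0 1 zero_lt_one)

theorem almostEq_symm {U V : Set X.H} (h : X.AlmostEq U V) : X.AlmostEq V U := by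
  unfold AlmostEq at *
  rwa [symmDiff_comm]

theorem almostEq_refl (U : Set X.H) : X.AlmostEq U U := by
  simp [AlmostEq]

/-- An infinite ideal contains a minimal UBS. -/
theorem IsIdeal.exists_minUBS (hnc : X.NoInfiniteCrossing) {D : Set X.H} (hD : IsIdeal o D)
    (hinf : D.Infinite) : ∃ U ⊆ D, X.MinUBS U := by
  obtain ⟨E, hED, hE, hEinf, hmin⟩ := hD.exists_minimal_ideal hnc hinf
  refine ⟨E, hED, hE.isUBS hEinf, fun U hUE hU => ?_⟩
  have hcore : (core o U).Infinite := fun hfin =>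
    hU.1 ((hfin.union (finite_diff_core hnc hU.2.2.2)).subset fun u hu => by
      by_cases h : u ∈ core o U
      exacts [Or.inl h, Or.inr ⟨hu, h⟩])
  have hsub : lowerHull o (core o U) ⊆ E := fun h ⟨s, hs, hle⟩ => hE.lower s (hUE hs.1) h hle
  have heq : lowerHull o (core o U) = E := by
    by_contra hne
    exact hcore ((hmin _ (hsub.ssubset_of_ne hne) (hU.isIdeal_lowerHull o)).subset
      (subset_lowerHull _))
  obtain ⟨t, ht⟩ := hcore.nonempty
  have hfin : {h | h ∈ E ∧ ¬ FarLe o t h}.Finite := by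
    refine hmin _ (Set.ssubset_iff_exists.2 ⟨fun h hh => hh.1, t, hUE ht.1,
      fun h => h.2 (FarLe.refl t)⟩) (hE.mono_meet (fun h hh => hh.1) ?_)
    exact fun h hh h' hle => ⟨hE.lower h hh.1 h' hle, fun hle' => hh.2 (hle'.trans hle)⟩
  refine hfin.subset fun h hh => ?_
  rcases hh with ⟨hhE, hhU⟩ | ⟨hhU, hhE⟩
  · refine ⟨hhE, fun hle => hhU ?_⟩
    obtain ⟨s, hs, hle'⟩ := heq.symm ▸ hhE
    by_cases h₁ : t = h
    · exact h₁ ▸ ht.1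
    by_cases h₂ : s = h
    · exact h₂ ▸ hs.1
    exact hU.2.1 t ht.1 s hs.1 h ⟨X.side h o, inHalf_near hle h₁, inHalf_far hle' h₂⟩
  · exact absurd (hUE hhU) hhE

/-! ### Overlapping ideals -/

/-- Two ideals with infinite intersection. -/
def Overlap (o : X.V) (D D' : Set X.H) : Prop :=
  IsIdeal o D ∧ IsIdeal o D' ∧ (D ∩ D').Infinite

theorem Overlap.symm {D D' : Set X.H} (h : Overlap o D D') : Overlap o D' D :=
  ⟨h.2.1, h.1, Set.inter_comm D D' ▸ h.2.2⟩

/-- Chains of overlapping ideals give avoiding paths of linear length. -/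
theorem exists_avoidPathLen_of_overlap {D D' : Set X.H} (hD : IsIdeal o D)
    (h : Relation.ReflTransGen (Overlap o) D D') :
    ∃ k : ℕ, ∀ r x y, sep o x ⊆ D → X.dist o x = r → sep o y ⊆ D' → X.dist o y = r →
      ∃ n ≤ k * r, X.AvoidPathLen o r x y n := by
  induction h with
  | refl => exact ⟨2, fun r x y hx hxr hy hyr => hD.exists_avoidPathLen hx hy hxr hyr⟩
  | tail _ hov ih =>
    obtain ⟨k, hk⟩ := ih
    refine ⟨k + 2, fun r x y hx hxr hy hyr => ?_⟩
    obtain ⟨z, hz, hzr⟩ := (hov.1.inter hov.2.1).exists_dist_eq r (Or.inl hov.2.2)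
    obtain ⟨m, hm, hp⟩ := hk r x z hx hxr (hz.trans Set.inter_subset_left) hzr
    obtain ⟨n, hn, hq⟩ := hov.2.1.exists_avoidPathLen (hz.trans Set.inter_subset_right) hy hzr hyr
    exact ⟨m + n, by rw [add_mul]; omega, hp.trans hq⟩

theorem AlmostEq.infinite_inter {U V S : Set X.H} (h : X.AlmostEq U V) (hU : (U ∩ S).Infinite) :
    (V ∩ S).Infinite := fun hfin => hU ((h.union hfin).subset fun x hx => by
  by_cases hxV : x ∈ V
  · exact Or.inr ⟨hxV, hx.2⟩
  · exact Or.inl (Or.inl ⟨hx.1, hxV⟩))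

theorem infinite_core_inter (hnc : X.NoInfiniteCrossing) (o : X.V) {U S : Set X.H}
    (hU : X.IsUBS U) (h : (U ∩ S).Infinite) : (core o U ∩ S).Infinite := fun hfin =>
  h (((finite_diff_core (o := o) hnc hU.2.2.2).union hfin).subset fun x hx => by
    by_cases hxU : x ∈ core o U
    · exact Or.inr ⟨hxU, hx.2⟩
    · exact Or.inl ⟨hx.1, hxU⟩)

theorem overlap_lowerHull_of_isIdeal (hnc : X.NoInfiniteCrossing) {U D : Set X.H}
    (hU : X.IsUBS U) (hD : IsIdeal o D) (h : (U ∩ D).Infinite) :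
    Overlap o (lowerHull o (core o U)) D :=
  ⟨hU.isIdeal_lowerHull o, hD, (infinite_core_inter hnc o hU h).mono
    (Set.inter_subset_inter_left _ (subset_lowerHull _))⟩

theorem overlap_lowerHull (hnc : X.NoInfiniteCrossing) (o : X.V) {U V : Set X.H}
    (hU : X.IsUBS U) (hV : X.IsUBS V) (h : (U ∩ V).Infinite) :
    Overlap o (lowerHull o (core o U)) (lowerHull o (core o V)) := by
  refine overlap_lowerHull_of_isIdeal hnc hU (hV.isIdeal_lowerHull o) ?_
  rw [Set.inter_comm] at h ⊢
  exact (infinite_core_inter hnc o hV h).mono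
    (Set.inter_subset_inter_left _ (subset_lowerHull _))

theorem FaceOf.infinite_inter {U V : Set X.H} (h : X.FaceOf U V) : (U ∩ V).Infinite := by
  obtain ⟨U', V', hU', -, hUU', hVV', hsub⟩ := h
  have h₁ : (U' ∩ V').Infinite := by rw [Set.inter_eq_left.2 hsub]; exact hU'.1
  have h₂ := (almostEq_symm hUU').infinite_inter h₁
  rw [Set.inter_comm] at h₂ ⊢
  exact (almostEq_symm hVV').infinite_inter h₂

/-- Minimal UBSs at finite distance in the simplicial boundary generate ideals joined by a chain of
overlapping ideals. -/
theorem overlap_of_bdist_ne_top (hnc : X.NoInfiniteCrossing) (o : X.V) {U U' : Set X.H}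
    (hU : X.MinUBS U) (hU' : X.MinUBS U') (h : X.bdist U U' ≠ ⊤) :
    Relation.ReflTransGen (Overlap o) (lowerHull o (core o U)) (lowerHull o (core o U')) := by
  have hae : ∀ V V', X.MinUBS V → X.MinUBS V' → X.AlmostEq V V' →
      Relation.ReflTransGen (Overlap o) (lowerHull o (core o V)) (lowerHull o (core o V')) := by
    intro V V' hV hV' h
    refine .single (overlap_lowerHull hnc o hV.1 hV'.1 ?_)
    have := h.infinite_inter (S := V) (by simpa using hV.1.1)
    rwa [Set.inter_comm]
  rw [bdist, Ne, sInf_eq_top] at h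
  push Not at h
  obtain ⟨_, ⟨n, c, h0, hn, hmin, hstep, rfl⟩, -⟩ := h
  have hchain : ∀ i ≤ n, Relation.ReflTransGen (Overlap o) (lowerHull o (core o (c 0)))
      (lowerHull o (core o (c i))) := by
    intro i
    induction i with
    | zero => exact fun _ => .refl
    | succ i ih =>
      intro hi
      refine (ih (by omega)).trans ?_
      rcases hstep i (by omega) with ⟨-, -, -, W, hW, hf, hf'⟩ | h
      · exact (Relation.ReflTransGen.single (overlap_lowerHull hnc o (hmin i (by omega)).1 hW
          hf.infinite_inter)).tail
          (overlap_lowerHull hnc o (hmin (i + 1) hi).1 hW hf'.infinite_inter).symm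
      · exact hae _ _ (hmin i (by omega)) (hmin _ hi) h
  exact ((hae _ _ hU (hmin 0 (Nat.zero_le _)) (almostEq_symm h0)).trans (hchain n le_rfl)).trans
    (hae _ _ (hmin n le_rfl) hU' hn)

theorem faceOf_of_subset {U V : Set X.H} (hU : X.IsUBS U) (hV : X.IsUBS V) (h : U ⊆ V) :
    X.FaceOf U V :=
  ⟨U, V, hU, hV, almostEq_refl U, almostEq_refl V, h⟩

/-- Edge-paths in the 1-skeleton of the simplicial boundary bound the distance. -/
theorem bdist_ne_top_of_reflTransGen {U V : Set X.H} (hU : X.MinUBS U)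
    (h : Relation.ReflTransGen
      (fun U V => X.MinUBS V ∧ (X.BAdj U V ∨ X.AlmostEq U V)) U V) : X.bdist U V ≠ ⊤ := by
  have key : ∃ (n : ℕ) (c : ℕ → Set X.H), c 0 = U ∧ c n = V ∧ (∀ i ≤ n, X.MinUBS (c i)) ∧
      ∀ i < n, X.BAdj (c i) (c (i + 1)) ∨ X.AlmostEq (c i) (c (i + 1)) := by
    induction h with
    | refl => exact ⟨0, fun _ => U, rfl, rfl, fun _ _ => hU, fun i hi => absurd hi (by omega)⟩
    | tail _ hVW ih =>
      rename_i V W _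
      obtain ⟨n, c, h0, hn, hmin, hstep⟩ := ih
      refine ⟨n + 1, fun i => if i ≤ n then c i else W, by simpa using h0, by simp,
        fun i _ => ?_, fun i hi => ?_⟩
      · by_cases hin : i ≤ n
        · simpa [hin] using hmin i hin
        · simpa [hin] using hVW.1
      · rcases Nat.lt_succ_iff_lt_or_eq.1 hi with hin | rfl
        · simpa [hin.le, Nat.succ_le_of_lt hin] using hstep i hin
        · simpa [hn] using hVW.2
  obtain ⟨n, c, rfl, rfl, hmin, hstep⟩ := key
  refine ne_top_of_le_ne_top (ENat.natCast_ne_top n) (sInf_le ?_)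
  exact ⟨n, c, almostEq_refl _, almostEq_refl _, hmin, hstep, rfl⟩

theorem badj_or_almostEq_of_subset {U V D : Set X.H} (hD : IsIdeal o D) (hU : X.MinUBS U)
    (hV : X.MinUBS V) (hUD : U ⊆ D) (hVD : V ⊆ D) : X.BAdj U V ∨ X.AlmostEq U V := by
  have hDU : X.IsUBS D := hD.isUBS (hU.1.1.mono hUD)
  by_cases h : X.AlmostEq U V
  · exact Or.inr h
  · exact Or.inl ⟨hU, hV, h, D, hDU, faceOf_of_subset hU.1 hDU hUD,
      faceOf_of_subset hV.1 hDU hVD⟩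

theorem bdist_ne_top_of_overlap (hnc : X.NoInfiniteCrossing) {D D' : Set X.H}
    (hD : IsIdeal o D) (h : Relation.ReflTransGen (Overlap o) D D') {U V : Set X.H}
    (hU : X.MinUBS U) (hV : X.MinUBS V) (hUD : U ⊆ D) (hVD : V ⊆ D') : X.bdist U V ≠ ⊤ := by
  refine bdist_ne_top_of_reflTransGen hU ?_
  induction h generalizing V with
  | refl => exact .single ⟨hV, badj_or_almostEq_of_subset hD hU hV hUD hVD⟩
  | tail _ hov ih =>
    obtain ⟨W, hW, hWm⟩ := (hov.1.inter hov.2.1).exists_minUBS hnc hov.2.2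
    exact (ih hWm (hW.trans Set.inter_subset_left)).tail
      ⟨hV, badj_or_almostEq_of_subset hov.2.1 hWm hV (hW.trans Set.inter_subset_right) hVD⟩

/-! ### Limits of ideals -/

/-- The hyperplanes belonging to almost all members of a sequence of sets of hyperplanes. -/
def limSet (𝒰 : Ultrafilter ℕ) (I : ℕ → Set X.H) : Set X.H := {h | ∀ᶠ s in 𝒰, h ∈ I s}

theorem isIdeal_limSet (𝒰 : Ultrafilter ℕ) {I : ℕ → Set X.H} (hI : ∀ s, IsIdeal o (I s)) :
    IsIdeal o (limSet 𝒰 I) := by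
  refine ⟨fun h hh h' hle => hh.mono fun s hs => (hI s).lower h hs h' hle, fun h hh h' hh' => ?_⟩
  obtain ⟨s, hs, hs'⟩ := (Filter.Eventually.and hh hh').exists
  exact (hI s).meet h hs h' hs'

theorem limSet_inter (𝒰 : Ultrafilter ℕ) (I J : ℕ → Set X.H) :
    limSet 𝒰 I ∩ limSet 𝒰 J = limSet 𝒰 fun s => I s ∩ J s :=
  Set.ext fun _ => Filter.eventually_and.symm

theorem infinite_limSet (hlf : X.LocallyFinite) {𝒰 : Ultrafilter ℕ}
    (h𝒰 : (𝒰 : Filter ℕ) ≤ Filter.atTop) {I : ℕ → Set X.H} (hI : ∀ s, IsIdeal o (I s))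
    (hcard : ∀ s, s ≤ (I s).ncard) : (limSet 𝒰 I).Infinite := by
  intro hfin
  have hev : ∀ᶠ s in (𝒰 : Filter ℕ),
      ∃ x ∈ {x | X.dist o x = (limSet 𝒰 I).ncard + 1}, sep o x ⊆ I s := by
    refine h𝒰 (Filter.eventually_atTop.2 ⟨(limSet 𝒰 I).ncard + 1, fun s hs => ?_⟩)
    obtain ⟨x, hx, hxn⟩ := (hI s).exists_dist_eq _ (Or.inr (hs.trans (hcard s)))
    exact ⟨x, hxn, hx⟩
  rw [Ultrafilter.eventually_exists_mem_iff (finite_sphere hlf o _)] at hev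
  obtain ⟨x, hx, hxI⟩ := hev
  have hsub : sep o x ⊆ limSet 𝒰 I := fun h hh => hxI.mono fun s hs => hs hh
  have := Set.ncard_le_ncard hsub hfin
  rw [← dist_eq_ncard, hx] at this
  omega

/-! ### Geodesic rays -/

theorem sep_subset_of_dist_add {x y z : X.V} (h : X.dist x y + X.dist y z = X.dist x z) :
    sep x y ⊆ sep x z ∧ sep y z ⊆ sep x z := by
  have heq : sep x z = sep x y ∪ sep y z :=
    Set.eq_of_subset_of_ncard_le (sep_subset_union x y z)
      (by simpa only [← dist_eq_ncard, h] using Set.ncard_union_le (sep x y) (sep y z))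
      ((finite_sep _ _).union (finite_sep _ _))
  rw [heq]
  exact ⟨Set.subset_union_left, Set.subset_union_right⟩

theorem IsGeodesicRay.dist_zero {γ : ℕ → X.V} (hγ : X.IsGeodesicRay γ) (n : ℕ) :
    X.dist (γ 0) (γ n) = n := by
  simpa using hγ 0 n (Nat.zero_le n)

theorem IsGeodesicRay.sep_mono {γ : ℕ → X.V} (hγ : X.IsGeodesicRay γ) {m n : ℕ} (h : m ≤ n) :
    sep (γ 0) (γ m) ⊆ sep (γ 0) (γ n) ∧ sep (γ m) (γ n) ⊆ sep (γ 0) (γ n) :=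
  sep_subset_of_dist_add (by rw [hγ.dist_zero, hγ.dist_zero, hγ m n h]; omega)

theorem IsGeodesicRay.mem_WSet {γ : ℕ → X.V} (hγ : X.IsGeodesicRay γ) {h : X.H} :
    h ∈ X.WSet γ ↔ ∃ n, h ∈ sep (γ 0) (γ n) := by
  constructor
  · rintro ⟨n, hn⟩
    exact ⟨n + 1, (hγ.sep_mono (Nat.le_succ n)).2 hn⟩
  · rintro ⟨n, hn⟩
    by_contra hc
    simp only [WSet, Set.mem_ofPred_eq, not_exists, not_not] at hc
    refine hn ?_
    clear hn
    induction n with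
    | zero => rfl
    | succ n ih => exact ih.trans (hc n)

theorem IsGeodesicRay.sep_subset_WSet {γ : ℕ → X.V} (hγ : X.IsGeodesicRay γ) (n : ℕ) :
    sep (γ 0) (γ n) ⊆ X.WSet γ := fun _ hh => hγ.mem_WSet.2 ⟨n, hh⟩

theorem IsGeodesicRay.isIdeal_WSet {γ : ℕ → X.V} (hγ : X.IsGeodesicRay γ) :
    IsIdeal (γ 0) (X.WSet γ) := by
  refine ⟨fun h hh h' hle => ?_, fun h hh h' hh' => ?_⟩
  · obtain ⟨n, hn⟩ := hγ.mem_WSet.1 hh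
    exact hγ.mem_WSet.2 ⟨n, hle _ hn⟩
  · obtain ⟨m, hm⟩ := hγ.mem_WSet.1 hh
    obtain ⟨n, hn⟩ := hγ.mem_WSet.1 hh'
    exact ⟨γ (max m n), (hγ.sep_mono (le_max_left m n)).1 hm,
      (hγ.sep_mono (le_max_right m n)).1 hn⟩

theorem IsGeodesicRay.infinite_WSet {γ : ℕ → X.V} (hγ : X.IsGeodesicRay γ) :
    (X.WSet γ).Infinite := by
  intro hfin
  have := Set.ncard_le_ncard (hγ.sep_subset_WSet ((X.WSet γ).ncard + 1)) hfin
  rw [← dist_eq_ncard, hγ.dist_zero] at this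
  omega

theorem IsGeodesicRay.WSet_subset_limSet {γ : ℕ → X.V} (hγ : X.IsGeodesicRay γ)
    {𝒰 : Ultrafilter ℕ} (h𝒰 : (𝒰 : Filter ℕ) ≤ Filter.atTop) :
    X.WSet γ ⊆ limSet 𝒰 fun s => sep (γ 0) (γ (2 * s)) := by
  intro h hh
  obtain ⟨n, hn⟩ := hγ.mem_WSet.1 hh
  exact h𝒰 (Filter.eventually_atTop.2
    ⟨n, fun s hs => (hγ.sep_mono (show n ≤ 2 * s by omega)).1 hn⟩)

/-! ### Linear divergence -/

theorem dist_le_of_path {c : ℕ → X.V} {n : ℕ} (hc : ∀ i < n, X.Adj (c i) (c (i + 1))) {i j : ℕ}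
    (hij : i ≤ j) (hj : j ≤ n) : X.dist (c i) (c j) ≤ j - i := by
  induction j, hij using Nat.le_induction with
  | base => simp [dist_eq_ncard, sep]
  | succ j hij ih =>
    obtain ⟨h, -, hu⟩ := hc j (by omega)
    have h₁ : X.dist (c j) (c (j + 1)) ≤ 1 := by
      rw [dist_eq_ncard]
      refine le_of_le_of_eq ?_ (Set.ncard_singleton h)
      exact Set.ncard_le_ncard (fun k hk => hu k hk) (Set.finite_singleton h)
    have h₂ := dist_triangle (c i) (c j) (c (j + 1))
    have := ih (by omega)
    omega

/-- Linearly bounded avoiding paths between two geodesic rays give a chain of overlapping ideals. -/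
theorem overlap_of_avoidPathLen (hlf : X.LocallyFinite) {γ δ : ℕ → X.V}
    (hγ : X.IsGeodesicRay γ) (hδ : X.IsGeodesicRay δ) (h0 : γ 0 = o) (h0' : δ 0 = o) {K : ℕ}
    (hK : ∀ s : ℕ, ∃ n ≤ K * s, X.AvoidPathLen o (2 * s) (γ (2 * s)) (δ (2 * s)) n) :
    Relation.ReflTransGen (Overlap o) (X.WSet γ) (X.WSet δ) := by
  choose n hn c hc0 hcn hadj hfar using hK
  let 𝒰 : Ultrafilter ℕ := Filter.hyperfilter ℕ
  have h𝒰 : (𝒰 : Filter ℕ) ≤ Filter.atTop := Nat.hyperfilter_le_atTop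
  let q : ℕ → ℕ → X.V := fun i s => c s (min (i * s) (n s))
  have hqid : ∀ i s, IsIdeal o (sep o (q i s)) := fun i s => isIdeal_sep o _
  have hov : ∀ i, Overlap o (limSet 𝒰 fun s => sep o (q i s))
      (limSet 𝒰 fun s => sep o (q (i + 1) s)) := by
    refine fun i => ⟨isIdeal_limSet 𝒰 (hqid i), isIdeal_limSet 𝒰 (hqid (i + 1)), ?_⟩
    rw [limSet_inter]
    refine infinite_limSet hlf h𝒰 (fun s => (hqid i s).inter (hqid (i + 1) s)) fun s => ?_
    have h₁ : 2 * s ≤ (sep o (q i s)).ncard := by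
      rw [← dist_eq_ncard, dist_comm]
      exact hfar s _ (min_le_right _ _)
    have h₂ : (sep (q i s) (q (i + 1) s)).ncard ≤ s := by
      rw [← dist_eq_ncard]
      refine (dist_le_of_path (hadj s) (min_le_min_right _ ?_) (min_le_right _ _)).trans ?_
      · exact Nat.mul_le_mul_right s (Nat.le_succ i)
      · rw [add_mul]
        omega
    have h₃ : sep o (q i s) ⊆ (sep o (q i s) ∩ sep o (q (i + 1) s)) ∪
        sep (q i s) (q (i + 1) s) := by
      intro h hh
      rcases sep_subset_union o (q (i + 1) s) (q i s) hh with h' | h'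
      · exact Or.inl ⟨hh, h'⟩
      · exact Or.inr (sep_comm (q (i + 1) s) (q i s) ▸ h')
    have h₄ := Set.ncard_le_ncard h₃ (((finite_sep _ _).inter_of_left _).union (finite_sep _ _))
    have h₅ := Set.ncard_union_le (sep o (q i s) ∩ sep o (q (i + 1) s))
      (sep (q i s) (q (i + 1) s))
    omega
  have hchain : ∀ i, Relation.ReflTransGen (Overlap o) (limSet 𝒰 fun s => sep o (q 0 s))
      (limSet 𝒰 fun s => sep o (q i s)) := by
    intro i
    induction i with
    | zero => exact .refl
    | succ i ih => exact ih.tail (hov i)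
  have hq0 : (fun s => sep o (q 0 s)) = fun s => sep (γ 0) (γ (2 * s)) := by
    simp [q, hc0, h0]
  have hqK : (fun s => sep o (q K s)) = fun s => sep (δ 0) (δ (2 * s)) := by
    funext s
    simp [q, min_eq_right (hn s), hcn, h0']
  have hγov : Overlap o (X.WSet γ) (limSet 𝒰 fun s => sep o (q 0 s)) := by
    refine ⟨h0 ▸ hγ.isIdeal_WSet, isIdeal_limSet 𝒰 (hqid 0), ?_⟩
    rw [hq0, Set.inter_eq_left.2 (hγ.WSet_subset_limSet h𝒰)]
    exact hγ.infinite_WSet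
  have hδov : Overlap o (X.WSet δ) (limSet 𝒰 fun s => sep o (q K s)) := by
    refine ⟨h0' ▸ hδ.isIdeal_WSet, isIdeal_limSet 𝒰 (hqid K), ?_⟩
    rw [hqK, Set.inter_eq_left.2 (hδ.WSet_subset_limSet h𝒰)]
    exact hδ.infinite_WSet
  exact ((Relation.ReflTransGen.single hγov).trans (hchain K)).tail hδov.symm

theorem IsGeodesicLine.isGeodesicRay {α : ℤ → X.V} (hα : X.IsGeodesicLine α) :
    X.IsGeodesicRay fun n : ℕ => α (n : ℤ) := fun m n hmn => by
  have := hα m n (by exact_mod_cast hmn)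
  dsimp only
  omega

theorem IsGeodesicLine.isGeodesicRay_neg {α : ℤ → X.V} (hα : X.IsGeodesicLine α) :
    X.IsGeodesicRay fun n : ℕ => α (-(n : ℤ)) := fun m n hmn => by
  have := hα (-n) (-m) (by omega)
  rw [dist_comm] at this
  dsimp only
  omega

end CCC

/-- **Corollary D / Corollary 7.8** (super-linear divergence).  Let `α` be a
bi-infinite combinatorial geodesic in a strongly locally finite CAT(0) cube
complex, representing the simplices `v⁻ = [W(α|_{(-∞,0]})]` and
`v⁺ = [W(α|_{[0,∞)})]` of `∂X`.  Then `v⁻` and `v⁺` lie in different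
components of `∂X` (no 0-face of `v⁻` is connected in `(∂X)¹` to a 0-face of
`v⁺`) iff the divergence of `α` is super-linear. -/
theorem superlinear_divergence_iff_different_components (X : CCC)
    (hlf : X.LocallyFinite) (hnc : X.NoInfiniteCrossing)
    (α : ℤ → X.V) (hα : X.IsGeodesicLine α) :
    (∀ U U' : Set X.H, X.MinUBS U → X.MinUBS U' →
        X.FaceOf U (X.WSet (fun n : ℕ => α (-(n : ℤ)))) →
        X.FaceOf U' (X.WSet (fun n : ℕ => α (n : ℤ))) →
        X.bdist U U' = ⊤) ↔
      (∀ A B : ℝ, ∃ r : ℕ, ∀ n : ℕ,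
        X.AvoidPathLen (α 0) r (α (-(r : ℤ))) (α (r : ℤ)) n →
          A * r + B < (n : ℝ)) := by
  have hp := hα.isGeodesicRay
  have hm := hα.isGeodesicRay_neg
  constructor
  · intro hinf A B
    by_contra! hc
    obtain ⟨K, hK⟩ := exists_nat_ge (|A| + |B|)
    have hov : Relation.ReflTransGen (CCC.Overlap (α 0)) (X.WSet fun n : ℕ => α (-(n : ℤ)))
        (X.WSet fun n : ℕ => α (n : ℤ)) := by
      refine CCC.overlap_of_avoidPathLen hlf hm hp (by simp) (by simp) (K := K * 2) fun s => ?_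
      rcases Nat.eq_zero_or_pos s with rfl | hs
      · exact ⟨0, le_rfl, by simpa using CCC.AvoidPathLen.refl (Nat.zero_le _)⟩
      obtain ⟨n, hn, hnle⟩ := hc (2 * s)
      refine ⟨n, ?_, hn⟩
      have hs' : (1 : ℝ) ≤ ((2 * s : ℕ) : ℝ) := by exact_mod_cast (by omega : 1 ≤ 2 * s)
      have h₁ : A * ((2 * s : ℕ) : ℝ) ≤ |A| * ((2 * s : ℕ) : ℝ) :=
        mul_le_mul_of_nonneg_right (le_abs_self A) (by positivity)
      have h₂ : B ≤ |B| * ((2 * s : ℕ) : ℝ) :=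
        (le_abs_self B).trans (le_mul_of_one_le_right (abs_nonneg B) hs')
      have h₃ := mul_le_mul_of_nonneg_right hK (zero_le_one.trans hs')
      have h₄ : (n : ℝ) ≤ K * ((2 * s : ℕ) : ℝ) := by linarith
      rw [mul_assoc]
      exact_mod_cast h₄
    have him : CCC.IsIdeal (α 0) (X.WSet fun n : ℕ => α (-(n : ℤ))) := by
      simpa using hm.isIdeal_WSet
    have hip : CCC.IsIdeal (α 0) (X.WSet fun n : ℕ => α (n : ℤ)) := by
      simpa using hp.isIdeal_WSet
    obtain ⟨U, hU, hUm⟩ := him.exists_minUBS hnc hm.infinite_WSet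
    obtain ⟨V, hV, hVm⟩ := hip.exists_minUBS hnc hp.infinite_WSet
    exact CCC.bdist_ne_top_of_overlap hnc him hov hUm hVm hU hV (hinf U V hUm hVm
      (CCC.faceOf_of_subset hUm.1 (him.isUBS hm.infinite_WSet) hU)
      (CCC.faceOf_of_subset hVm.1 (hip.isUBS hp.infinite_WSet) hV))
  · intro hdiv U V hU hV hUm hVp
    by_contra hne
    have him : CCC.IsIdeal (α 0) (X.WSet fun n : ℕ => α (-(n : ℤ))) := by
      simpa using hm.isIdeal_WSet
    have hip : CCC.IsIdeal (α 0) (X.WSet fun n : ℕ => α (n : ℤ)) := by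
      simpa using hp.isIdeal_WSet
    obtain ⟨k, hk⟩ := CCC.exists_avoidPathLen_of_overlap him
      (((Relation.ReflTransGen.single (CCC.overlap_lowerHull_of_isIdeal hnc hU.1 him
        hUm.infinite_inter).symm).trans (CCC.overlap_of_bdist_ne_top hnc (α 0) hU hV hne)).tail
        (CCC.overlap_lowerHull_of_isIdeal hnc hV.1 hip hVp.infinite_inter))
    obtain ⟨r, hr⟩ := hdiv k 0
    obtain ⟨n, hn, hpath⟩ := hk r (α (-(r : ℤ))) (α (r : ℤ)) (by simpa using hm.sep_subset_WSet r)
      (by simpa using hm.dist_zero r) (by simpa using hp.sep_subset_WSet r)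
      (by simpa using hp.dist_zero r)
    have h₁ := hr n hpath
    have h₂ : (n : ℝ) ≤ k * r := by exact_mod_cast hn
    linarith
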